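/- arXiv:1901.02924 — 2 statements merged into one kernel-verified Lean document; each statement's English description precedes it below -/
import Mathlib

section
/- Let φ ≥ 0 be a measurable function on (0,1)^d such that for some constant c > 0, the Lebesgue measure of {ξ ∈ (0,1)^d : φ(ξ) ≥ s} is at most c/s for all s > 0. Then for every 1 < p ≤ 2 there exists a constant c_p > 0 such that for all f ∈ ℓ^p(ℤ^d): (∫_{(0,1)^d} |F(f)(ξ)|^p φ(ξ)^{2−p} dξ)^{1/p} ≤ c_p ‖f‖_{ℓ^p}. -/
open MeasureTheory Real Complex

/-- The open unit cube `(0,1)^d` in `ℝ^d`. -/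
noncomputable def unitCube (d : ℕ) : Set (Fin d → ℝ) :=
  Set.univ.pi fun _ => Set.Ioo (0 : ℝ) 1

/-- Discrete Fourier transform on `ℤ^d`: `F(f)(ξ) = ∑_{n ∈ ℤ^d} f(n) e^{2πi n·ξ}`. -/
noncomputable def dft (d : ℕ) (f : (Fin d → ℤ) → ℂ) (ξ : Fin d → ℝ) : ℂ :=
  ∑' n : Fin d → ℤ, f n * Complex.exp (2 * Real.pi * Complex.I * ∑ i, (n i : ℂ) * (ξ i : ℂ))

/-- The character `ξ ↦ e^{2πi n·ξ}` of `ℝ^d`. -/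
noncomputable def latticeChar (d : ℕ) (n : Fin d → ℤ) (ξ : Fin d → ℝ) : ℂ :=
  Complex.exp (2 * Real.pi * Complex.I * ∑ i, (n i : ℂ) * (ξ i : ℂ))

lemma continuous_latticeChar (d : ℕ) (n : Fin d → ℤ) : Continuous (latticeChar d n) := by
  unfold latticeChar
  fun_prop

lemma norm_latticeChar (d : ℕ) (n : Fin d → ℤ) (ξ : Fin d → ℝ) : ‖latticeChar d n ξ‖ = 1 := by
  have : (2 * Real.pi * Complex.I * ∑ i, (n i : ℂ) * (ξ i : ℂ))
      = ((2 * Real.pi * ∑ i, (n i : ℝ) * ξ i : ℝ) : ℂ) * Complex.I := by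
    push_cast
    ring
  rw [latticeChar, this, Complex.norm_exp_ofReal_mul_I]

lemma norm_mul_latticeChar (d : ℕ) (a : ℂ) (n : Fin d → ℤ) (ξ : Fin d → ℝ) :
    ‖a * latticeChar d n ξ‖ = ‖a‖ := by
  rw [norm_mul, norm_latticeChar, mul_one]

lemma latticeChar_mul_conj (d : ℕ) (m n : Fin d → ℤ) (ξ : Fin d → ℝ) :
    latticeChar d m ξ * (starRingEnd ℂ) (latticeChar d n ξ) = latticeChar d (m - n) ξ := by
  simp only [latticeChar]
  rw [← Complex.exp_conj, ← Complex.exp_add]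
  congr 1
  simp [sub_mul, Finset.sum_sub_distrib, map_ofNat (starRingEnd ℂ) 2]
  ring

lemma integral_Ioo_exp_two_pi_int (k : ℤ) :
    ∫ x in Set.Ioo (0 : ℝ) 1, Complex.exp (2 * Real.pi * Complex.I * ((k : ℂ) * (x : ℂ)))
      = if k = 0 then 1 else 0 := by
  rw [← integral_Ioc_eq_integral_Ioo, ← intervalIntegral.integral_of_le zero_le_one]
  split_ifs with hk
  · simp [hk]
  · have h0 : (2 * Real.pi * Complex.I * (k : ℂ)) ≠ 0 := by
      simp [hk, Real.pi_ne_zero]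
    simp_rw [← mul_assoc]
    rw [integral_exp_mul_complex h0]
    have : Complex.exp (2 * Real.pi * Complex.I * k) = 1 := by
      rw [mul_comm]
      exact Complex.exp_int_mul_two_pi_mul_I k
    simp [this]

lemma volume_restrict_unitCube (d : ℕ) :
    (volume : Measure (Fin d → ℝ)).restrict (unitCube d)
      = Measure.pi fun _ => (volume : Measure ℝ).restrict (Set.Ioo 0 1) := by
  rw [unitCube, volume_pi, Measure.restrict_pi_pi]

instance isProbabilityMeasure_restrict_unitCube (d : ℕ) :
    IsProbabilityMeasure ((volume : Measure (Fin d → ℝ)).restrict (unitCube d)) := by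
  refine ⟨?_⟩
  simp [volume_restrict_unitCube, Measure.pi_univ]

lemma integral_latticeChar (d : ℕ) (n : Fin d → ℤ) :
    ∫ ξ in unitCube d, latticeChar d n ξ = if n = 0 then 1 else 0 := by
  simp only [latticeChar, volume_restrict_unitCube, Finset.mul_sum, Complex.exp_sum]
  rw [integral_fintype_prod_eq_prod (𝕜 := ℂ)
    (f := fun i (x : ℝ) => Complex.exp (2 * Real.pi * Complex.I * ((n i : ℂ) * (x : ℂ))))]
  simp_rw [integral_Ioo_exp_two_pi_int]
  split_ifs with h
  · simp [h]
  · obtain ⟨i, hi⟩ := Function.ne_iff.mp h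
    exact Finset.prod_eq_zero (Finset.mem_univ i) (if_neg hi)

lemma integral_norm_sq_trigPoly (d : ℕ) (f : (Fin d → ℤ) → ℂ) (S : Finset (Fin d → ℤ)) :
    ∫ ξ in unitCube d, ‖∑ n ∈ S, f n * latticeChar d n ξ‖ ^ 2 = ∑ n ∈ S, ‖f n‖ ^ 2 := by
  have hpt (ξ : Fin d → ℝ) : ((‖∑ n ∈ S, f n * latticeChar d n ξ‖ ^ 2 : ℝ) : ℂ)
      = ∑ m ∈ S, ∑ n ∈ S, f m * (starRingEnd ℂ) (f n) * latticeChar d (m - n) ξ := by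
    push_cast
    rw [← Complex.mul_conj', map_sum, Finset.sum_mul_sum]
    refine Finset.sum_congr rfl fun m _ => Finset.sum_congr rfl fun n _ => ?_
    rw [← latticeChar_mul_conj, map_mul]
    ring
  have hint (n : Fin d → ℤ) (a : ℂ) :
      Integrable (fun ξ => a * latticeChar d n ξ) (volume.restrict (unitCube d)) :=
    (Integrable.of_bound (continuous_latticeChar d n).aestronglyMeasurable 1
      (.of_forall fun ξ => (norm_latticeChar d n ξ).le)).const_mul a
  apply Complex.ofReal_injective
  rw [← integral_complex_ofReal, integral_congr_ae (.of_forall hpt)]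
  rw [integral_finsetSum _ fun m _ => integrable_finsetSum _ fun n _ => hint _ _]
  push_cast
  refine Finset.sum_congr rfl fun m hm => ?_
  rw [integral_finsetSum _ fun n _ => hint _ _]
  simp_rw [integral_const_mul, integral_latticeChar, sub_eq_zero]
  simp [hm, Complex.mul_conj']

lemma summable_mul_latticeChar {d : ℕ} {f : (Fin d → ℤ) → ℂ} (hf : Summable fun n => ‖f n‖)
    (ξ : Fin d → ℝ) : Summable fun n => f n * latticeChar d n ξ := by
  refine .of_norm ?_
  simpa [norm_latticeChar] using hf

lemma norm_dft_le {d : ℕ} {f : (Fin d → ℤ) → ℂ} (hf : Summable fun n => ‖f n‖)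
    (ξ : Fin d → ℝ) : ‖dft d f ξ‖ ≤ ∑' n, ‖f n‖ := by
  refine tsum_of_norm_bounded hf.hasSum fun n => ?_
  exact (norm_mul_latticeChar d (f n) n ξ).le

lemma continuous_dft {d : ℕ} {f : (Fin d → ℤ) → ℂ} (hf : Summable fun n => ‖f n‖) :
    Continuous (dft d f) := by
  refine continuous_tsum (fun n => (continuous_latticeChar d n).const_mul (f n)) hf fun n ξ => ?_
  exact (norm_mul_latticeChar d (f n) n ξ).le

lemma dft_add {d : ℕ} {f g : (Fin d → ℤ) → ℂ} (hf : Summable fun n => ‖f n‖)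
    (hg : Summable fun n => ‖g n‖) (ξ : Fin d → ℝ) :
    dft d (f + g) ξ = dft d f ξ + dft d g ξ := by
  refine Eq.trans ?_
    ((summable_mul_latticeChar hf ξ).tsum_add (summable_mul_latticeChar hg ξ))
  simp [dft, latticeChar, add_mul]

/-- Parseval's identity for absolutely summable coefficients. -/
lemma hasSum_integral_norm_sq_dft {d : ℕ} {f : (Fin d → ℤ) → ℂ}
    (hf : Summable fun n => ‖f n‖) :
    HasSum (fun n => ‖f n‖ ^ 2) (∫ ξ in unitCube d, ‖dft d f ξ‖ ^ 2) := by
  unfold HasSum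
  simp_rw [← integral_norm_sq_trigPoly]
  refine tendsto_integral_filter_of_dominated_convergence (fun _ => (∑' n, ‖f n‖) ^ 2)
    (.of_forall fun S => ?_) (.of_forall fun S => .of_forall fun ξ => ?_)
    (integrable_const _) (.of_forall fun ξ => ?_)
  · have := continuous_latticeChar d
    exact Continuous.aestronglyMeasurable (by fun_prop)
  · rw [Real.norm_of_nonneg (by positivity)]
    gcongr
    refine (norm_sum_le _ _).trans ?_
    simp only [norm_mul, norm_latticeChar, mul_one]
    exact hf.sum_le_tsum S fun _ _ => norm_nonneg _
  · exact ((summable_mul_latticeChar hf ξ).hasSum.norm).pow 2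

lemma lintegral_norm_sq_dft {d : ℕ} {f : (Fin d → ℤ) → ℂ} (hf : Summable fun n => ‖f n‖) :
    ∫⁻ ξ in unitCube d, ENNReal.ofReal (‖dft d f ξ‖ ^ 2)
      = ENNReal.ofReal (∑' n, ‖f n‖ ^ 2) := by
  rw [(hasSum_integral_norm_sq_dft hf).tsum_eq, ofReal_integral_eq_lintegral_ofReal]
  · refine Integrable.of_bound ((continuous_dft hf).norm.pow 2).aestronglyMeasurable
      ((∑' n, ‖f n‖) ^ 2) (.of_forall fun ξ => ?_)
    rw [Real.norm_of_nonneg (by positivity)]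
    gcongr
    exact norm_dft_le hf ξ
  · exact .of_forall fun ξ => by positivity

lemma withDensity_sq_sublevel_le {α : Type*} [MeasurableSpace α] {μ : Measure α} {φ : α → ℝ}
    (hφ : Measurable φ) (hφ0 : ∀ x, 0 ≤ φ x) {c : ℝ}
    (hdist : ∀ s : ℝ, 0 < s → μ {x | s ≤ φ x} ≤ ENNReal.ofReal (c / s)) {a : ℝ} (ha : 0 ≤ a) :
    μ.withDensity (fun x => ENNReal.ofReal (φ x ^ 2)) {x | φ x ≤ a}
      ≤ ENNReal.ofReal (2 * c * a) := by
  have hs : MeasurableSet {x | φ x ≤ a} := measurableSet_le hφ measurable_const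
  set ψ : α → ℝ := {x | φ x ≤ a}.indicator φ with hψ
  have hψm : Measurable ψ := hφ.indicator hs
  have hψ0 : ∀ x, 0 ≤ ψ x := Set.indicator_nonneg fun x _ => hφ0 x
  have hψφ : ∀ x, ψ x ≤ φ x := Set.indicator_le_self' fun x _ => hφ0 x
  have hψa : ∀ x, ψ x ≤ a := fun x => Set.indicator_apply_le' (fun h => h) fun _ => ha
  have key : ∫⁻ t in Set.Ioi (0 : ℝ), μ {x | t ≤ ψ x} * ENNReal.ofReal (t ^ ((2 : ℝ) - 1))
      ≤ ∫⁻ t in Set.Ioi (0 : ℝ), (Set.Iic a).indicator (fun _ => ENNReal.ofReal c) t := by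
    refine setLIntegral_mono' measurableSet_Ioi fun t (ht : 0 < t) => ?_
    by_cases hta : t ≤ a
    · rw [Set.indicator_of_mem (show t ∈ Set.Iic a from hta)]
      calc μ {x | t ≤ ψ x} * ENNReal.ofReal (t ^ ((2 : ℝ) - 1))
          ≤ ENNReal.ofReal (c / t) * ENNReal.ofReal (t ^ ((2 : ℝ) - 1)) := by
            gcongr
            exact (measure_mono fun x (hx : t ≤ ψ x) => hx.trans (hψφ x)).trans (hdist t ht)
        _ = ENNReal.ofReal c := by
            rw [← ENNReal.ofReal_mul' (by positivity)]
            norm_num [div_mul_cancel₀, ht.ne']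
    · have : {x | t ≤ ψ x} = ∅ := by
        ext x
        simpa using (hψa x).trans_lt (not_le.mp hta)
      simp [this]
  calc μ.withDensity (fun x => ENNReal.ofReal (φ x ^ 2)) {x | φ x ≤ a}
      = ∫⁻ x, ENNReal.ofReal (ψ x ^ (2 : ℝ)) ∂μ := by
        rw [withDensity_apply _ hs, ← lintegral_indicator hs]
        refine lintegral_congr fun x => ?_
        by_cases hx : φ x ≤ a <;> simp [hψ, Set.indicator, hx]
    _ ≤ ENNReal.ofReal 2 *
          ∫⁻ t in Set.Ioi (0 : ℝ), (Set.Iic a).indicator (fun _ => ENNReal.ofReal c) t := by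
        rw [lintegral_rpow_eq_lintegral_meas_le_mul μ (.of_forall hψ0) hψm.aemeasurable two_pos]
        gcongr
    _ = ENNReal.ofReal (2 * c * a) := by
        rw [lintegral_indicator measurableSet_Iic, Measure.restrict_restrict measurableSet_Iic,
          Set.Iic_inter_Ioi, setLIntegral_const, Real.volume_Ioc, sub_zero,
          ← ENNReal.ofReal_mul' ha, ← ENNReal.ofReal_mul zero_le_two, mul_assoc]

lemma lintegral_indicator_Iio_rpow_le {p x : ℝ} (hp : 1 < p) (hx : 0 ≤ x) :
    ∫⁻ t in Set.Ioi (0 : ℝ), (Set.Iio x).indicator (fun t => ENNReal.ofReal (x * t ^ (p - 2))) t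
      ≤ ENNReal.ofReal (x ^ p / (p - 1)) := by
  rw [lintegral_indicator measurableSet_Iio, Measure.restrict_restrict measurableSet_Iio,
    Set.Iio_inter_Ioi, ← ofReal_integral_eq_lintegral_ofReal]
  · rw [← integral_Ioc_eq_integral_Ioo, ← intervalIntegral.integral_of_le hx,
      intervalIntegral.integral_const_mul, integral_rpow (.inl (by linarith)),
      show p - 2 + 1 = p - 1 by ring, Real.zero_rpow (by linarith), sub_zero, ← mul_div_assoc]
    rcases hx.eq_or_lt with rfl | hx
    · simp
    · rw [Real.rpow_sub_one hx.ne', mul_div_cancel₀ _ hx.ne']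
  · have := (intervalIntegral.intervalIntegrable_rpow' (a := 0) (b := x)
      (show -1 < p - 2 by linarith)).const_mul x
    rw [intervalIntegrable_iff_integrableOn_Ioo_of_le hx] at this
    exact this
  · refine ae_restrict_of_forall_mem measurableSet_Ioo fun t ht => ?_
    have := ht.1
    positivity

lemma lintegral_indicator_Ici_rpow_le {p x : ℝ} (hp : p < 2) (hx : 0 ≤ x) :
    ∫⁻ t in Set.Ioi (0 : ℝ),
        (Set.Ici x).indicator (fun t => ENNReal.ofReal (x ^ 2 * t ^ (p - 3))) t
      ≤ ENNReal.ofReal (x ^ p / (2 - p)) := by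
  rcases hx.eq_or_lt with rfl | hx
  · simp
  rw [lintegral_indicator measurableSet_Ici, Measure.restrict_restrict measurableSet_Ici,
    Set.inter_eq_left.2 (Set.Ici_subset_Ioi.2 hx), ← restrict_Ioi_eq_restrict_Ici,
    ← ofReal_integral_eq_lintegral_ofReal]
  · rw [integral_const_mul, integral_Ioi_rpow_of_lt (by linarith) hx,
      show p - 3 + 1 = p - 2 by ring, Real.rpow_sub hx, Real.rpow_two]
    refine le_of_eq (congrArg _ ?_)
    have : p - 2 ≠ 0 := by linarith
    have : 2 - p ≠ 0 := by linarith
    field_simp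
    ring
  · exact (integrableOn_Ioi_rpow_of_lt (by linarith) hx).const_mul _
  · refine ae_restrict_of_forall_mem measurableSet_Ioi fun t ht => ?_
    have : 0 < t := hx.trans ht
    positivity

lemma withDensity_sq_weak_two {α : Type*} [MeasurableSpace α] {μ : Measure α} {φ F : α → ℝ}
    (hφ : Measurable φ) (hφ0 : ∀ x, 0 ≤ φ x) (hF : Measurable F) {t : ℝ} (ht : 0 < t) :
    μ.withDensity (fun x => ENNReal.ofReal (φ x ^ 2)) {x | t / 2 * φ x ≤ F x}
      ≤ ENNReal.ofReal (4 / t ^ 2) * ∫⁻ x, ENNReal.ofReal (F x ^ 2) ∂μ := by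
  have hs : MeasurableSet {x | t / 2 * φ x ≤ F x} := measurableSet_le (by fun_prop) hF
  rw [withDensity_apply _ hs, ← lintegral_const_mul _ (by fun_prop)]
  refine (setLIntegral_mono' hs fun x (hx : t / 2 * φ x ≤ F x) => ?_).trans
    (setLIntegral_le_lintegral _ _)
  rw [← ENNReal.ofReal_mul (by positivity)]
  refine ENNReal.ofReal_le_ofReal ?_
  have h0 : 0 ≤ t / 2 * φ x := mul_nonneg (by positivity) (hφ0 x)
  calc φ x ^ 2 = 4 / t ^ 2 * (t / 2 * φ x) ^ 2 := by field_simp; norm_num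
    _ ≤ 4 / t ^ 2 * F x ^ 2 := by gcongr

lemma withDensity_sq_dft_superlevel_le {d : ℕ} {φ : (Fin d → ℝ) → ℝ} (hφ : Measurable φ)
    (hφ0 : ∀ ξ, 0 ≤ φ ξ) {c : ℝ} (hc : 0 < c)
    (hdist : ∀ s : ℝ, 0 < s →
      volume.restrict (unitCube d) {ξ | s ≤ φ ξ} ≤ ENNReal.ofReal (c / s))
    {f : (Fin d → ℤ) → ℂ} (hf : Summable fun n => ‖f n‖) (p : ℝ) {t : ℝ} (ht : 0 < t) :
    (volume.restrict (unitCube d)).withDensity (fun ξ => ENNReal.ofReal (φ ξ ^ 2))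
        {ξ | t < ‖dft d f ξ‖ / φ ξ} * ENNReal.ofReal (t ^ (p - 1))
      ≤ ENNReal.ofReal (4 * c) * ∑' n,
          (Set.Iio ‖f n‖).indicator (fun t => ENNReal.ofReal (‖f n‖ * t ^ (p - 2))) t
        + ENNReal.ofReal 4 * ∑' n,
          (Set.Ici ‖f n‖).indicator (fun t => ENNReal.ofReal (‖f n‖ ^ 2 * t ^ (p - 3))) t := by
  set ν := (volume.restrict (unitCube d)).withDensity (fun ξ => ENNReal.ofReal (φ ξ ^ 2))
  set fb : (Fin d → ℤ) → ℂ := fun n => if t < ‖f n‖ then f n else 0 with hfb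
  set fs : (Fin d → ℤ) → ℂ := fun n => if t < ‖f n‖ then 0 else f n with hfs
  have hsum : f = fb + fs := by
    ext n
    by_cases h : t < ‖f n‖ <;> simp [hfb, hfs, h]
  have hb : Summable fun n => ‖fb n‖ := by
    refine hf.of_nonneg_of_le (fun _ => norm_nonneg _) fun n => ?_
    by_cases h : t < ‖f n‖ <;> simp [hfb, h]
  have hs : Summable fun n => ‖fs n‖ := by
    refine hf.of_nonneg_of_le (fun _ => norm_nonneg _) fun n => ?_
    by_cases h : t < ‖f n‖ <;> simp [hfs, h]
  have hs2 : Summable fun n => ‖fs n‖ ^ 2 := (hasSum_integral_norm_sq_dft hs).summable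
  have hsub : {ξ | t < ‖dft d f ξ‖ / φ ξ}
      ⊆ {ξ | φ ξ ≤ 2 * (∑' n, ‖fb n‖) / t} ∪ {ξ | t / 2 * φ ξ ≤ ‖dft d fs ξ‖} := by
    intro ξ (hξ : t < ‖dft d f ξ‖ / φ ξ)
    rw [Set.mem_union, Set.mem_ofPred_eq, Set.mem_ofPred_eq, or_iff_not_imp_right, not_le]
    intro hlt
    have hpos : 0 < φ ξ := (hφ0 ξ).lt_of_ne fun h => by
      rw [← h, div_zero] at hξ
      exact hξ.not_gt ht
    rw [lt_div_iff₀ hpos, hsum, dft_add hb hs] at hξ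
    rw [le_div_iff₀ ht]
    linarith [norm_add_le (dft d fb ξ) (dft d fs ξ), norm_dft_le hb ξ]
  have hB : 0 ≤ ∑' n, ‖fb n‖ := tsum_nonneg fun _ => norm_nonneg _
  have htp2 : t ^ (p - 2) = t ^ (p - 1) / t := by
    rw [← Real.rpow_sub_one ht.ne']
    ring_nf
  have htp3 : t ^ (p - 3) = t ^ (p - 1) / t ^ 2 := by
    rw [← Real.rpow_two, ← Real.rpow_sub ht]
    ring_nf
  have hν : ν {ξ | t < ‖dft d f ξ‖ / φ ξ} ≤ ENNReal.ofReal (2 * c * (2 * (∑' n, ‖fb n‖) / t))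
      + ENNReal.ofReal (4 / t ^ 2) * ENNReal.ofReal (∑' n, ‖fs n‖ ^ 2) := by
    refine (measure_mono hsub).trans ((measure_union_le _ _).trans (add_le_add ?_ ?_))
    · exact withDensity_sq_sublevel_le hφ hφ0 hdist (by positivity)
    · rw [← lintegral_norm_sq_dft hs]
      exact withDensity_sq_weak_two hφ hφ0 (continuous_dft hs).norm.measurable ht
  have hbig : ENNReal.ofReal (2 * c * (2 * (∑' n, ‖fb n‖) / t)) * ENNReal.ofReal (t ^ (p - 1))
      = ENNReal.ofReal (4 * c) * ∑' n,
          (Set.Iio ‖f n‖).indicator (fun t => ENNReal.ofReal (‖f n‖ * t ^ (p - 2))) t := by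
    have : ∀ n, (Set.Iio ‖f n‖).indicator (fun t => ENNReal.ofReal (‖f n‖ * t ^ (p - 2))) t
        = ENNReal.ofReal (‖fb n‖ * t ^ (p - 2)) := fun n => by
      by_cases h : t < ‖f n‖ <;> simp [hfb, Set.indicator, h]
    simp_rw [this]
    rw [← ENNReal.ofReal_tsum_of_nonneg (fun n => by positivity) (hb.mul_right _), tsum_mul_right,
      ← ENNReal.ofReal_mul (by positivity), ← ENNReal.ofReal_mul (by positivity), htp2]
    congr 1
    ring
  have hsmall : ENNReal.ofReal (4 / t ^ 2) * ENNReal.ofReal (∑' n, ‖fs n‖ ^ 2)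
        * ENNReal.ofReal (t ^ (p - 1))
      = ENNReal.ofReal 4 * ∑' n,
          (Set.Ici ‖f n‖).indicator (fun t => ENNReal.ofReal (‖f n‖ ^ 2 * t ^ (p - 3))) t := by
    have : ∀ n, (Set.Ici ‖f n‖).indicator (fun t => ENNReal.ofReal (‖f n‖ ^ 2 * t ^ (p - 3))) t
        = ENNReal.ofReal (‖fs n‖ ^ 2 * t ^ (p - 3)) := fun n => by
      by_cases h : t < ‖f n‖
      · simp [hfs, h]
      · simp [hfs, h, not_lt.mp h]
    simp_rw [this]
    rw [← ENNReal.ofReal_tsum_of_nonneg (fun n => by positivity) (hs2.mul_right _), tsum_mul_right,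
      ← ENNReal.ofReal_mul (by positivity), ← ENNReal.ofReal_mul (by positivity),
      ← ENNReal.ofReal_mul (by positivity), htp3]
    congr 1
    ring
  rw [← hbig, ← hsmall, ← add_mul]
  gcongr

lemma lintegral_norm_dft_rpow_mul_le {d : ℕ} {φ : (Fin d → ℝ) → ℝ} (hφ : Measurable φ)
    (hφ0 : ∀ ξ, 0 ≤ φ ξ) {c : ℝ} (hc : 0 < c)
    (hdist : ∀ s : ℝ, 0 < s →
      volume.restrict (unitCube d) {ξ | s ≤ φ ξ} ≤ ENNReal.ofReal (c / s))
    {p : ℝ} (hp : 1 < p) (hp2 : p < 2) {f : (Fin d → ℤ) → ℂ} (hf : Summable fun n => ‖f n‖)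
    (hfp : Summable fun n => ‖f n‖ ^ p) :
    ∫⁻ ξ in unitCube d, ENNReal.ofReal (‖dft d f ξ‖ ^ p * φ ξ ^ (2 - p))
      ≤ ENNReal.ofReal (p * (4 * c / (p - 1) + 4 / (2 - p)) * ∑' n, ‖f n‖ ^ p) := by
  have hp1 : 0 < p - 1 := by linarith
  have h2p : 0 < 2 - p := by linarith
  have hFm : Measurable fun ξ => ‖dft d f ξ‖ := (continuous_dft hf).norm.measurable
  have hX : 0 ≤ ∑' n, ‖f n‖ ^ p := tsum_nonneg fun _ => by positivity
  have hg0 : ∀ ξ, 0 ≤ ‖dft d f ξ‖ / φ ξ := fun ξ => div_nonneg (norm_nonneg _) (hφ0 ξ)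
  have hpt (ξ : Fin d → ℝ) : ENNReal.ofReal (‖dft d f ξ‖ ^ p * φ ξ ^ (2 - p))
      = ENNReal.ofReal (φ ξ ^ 2) * ENNReal.ofReal ((‖dft d f ξ‖ / φ ξ) ^ p) := by
    rw [← ENNReal.ofReal_mul (by positivity)]
    congr 1
    rcases (hφ0 ξ).eq_or_lt with h | h
    · simp [← h, Real.zero_rpow h2p.ne']
    · rw [Real.div_rpow (norm_nonneg _) h.le, Real.rpow_sub h, Real.rpow_two]
      ring
  have hI1 : ∀ n, Measurable
      ((Set.Iio ‖f n‖).indicator fun t => ENNReal.ofReal (‖f n‖ * t ^ (p - 2))) := fun n =>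
    Measurable.indicator (by fun_prop) measurableSet_Iio
  have hI2 : ∀ n, Measurable
      ((Set.Ici ‖f n‖).indicator fun t => ENNReal.ofReal (‖f n‖ ^ 2 * t ^ (p - 3))) := fun n =>
    Measurable.indicator (by fun_prop) measurableSet_Ici
  have hsum (a : ℝ) (ha : 0 < a) : ∑' n, ENNReal.ofReal (‖f n‖ ^ p / a)
      = ENNReal.ofReal ((∑' n, ‖f n‖ ^ p) / a) := by
    rw [← ENNReal.ofReal_tsum_of_nonneg (fun n => by positivity) (hfp.div_const a), tsum_div_const]
  calc ∫⁻ ξ in unitCube d, ENNReal.ofReal (‖dft d f ξ‖ ^ p * φ ξ ^ (2 - p))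
      = ∫⁻ ξ, ENNReal.ofReal ((‖dft d f ξ‖ / φ ξ) ^ p) ∂(volume.restrict (unitCube d)).withDensity
          (fun ξ => ENNReal.ofReal (φ ξ ^ 2)) := by
        simp_rw [hpt]
        rw [lintegral_withDensity_eq_lintegral_mul _ (by fun_prop) (by fun_prop)]
        rfl
    _ ≤ ENNReal.ofReal p * ∫⁻ t in Set.Ioi (0 : ℝ), (ENNReal.ofReal (4 * c) * ∑' n,
          (Set.Iio ‖f n‖).indicator (fun t => ENNReal.ofReal (‖f n‖ * t ^ (p - 2))) t
        + ENNReal.ofReal 4 * ∑' n,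
          (Set.Ici ‖f n‖).indicator (fun t => ENNReal.ofReal (‖f n‖ ^ 2 * t ^ (p - 3))) t) := by
        rw [lintegral_rpow_eq_lintegral_meas_lt_mul _ (.of_forall hg0)
          (hFm.div hφ).aemeasurable (by linarith)]
        gcongr ENNReal.ofReal p * ?_
        exact setLIntegral_mono' measurableSet_Ioi fun t ht =>
          withDensity_sq_dft_superlevel_le hφ hφ0 hc hdist hf p ht
    _ ≤ ENNReal.ofReal p * (ENNReal.ofReal (4 * c) * ∑' n, ENNReal.ofReal (‖f n‖ ^ p / (p - 1))
        + ENNReal.ofReal 4 * ∑' n, ENNReal.ofReal (‖f n‖ ^ p / (2 - p))) := by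
        rw [lintegral_add_left ((Measurable.tsum hI1).const_mul _),
          lintegral_const_mul _ (Measurable.tsum hI1),
          lintegral_const_mul _ (Measurable.tsum hI2),
          lintegral_tsum fun n => (hI1 n).aemeasurable,
          lintegral_tsum fun n => (hI2 n).aemeasurable]
        gcongr with n n
        · exact lintegral_indicator_Iio_rpow_le hp (norm_nonneg _)
        · exact lintegral_indicator_Ici_rpow_le hp2 (norm_nonneg _)
    _ = ENNReal.ofReal (p * (4 * c / (p - 1) + 4 / (2 - p)) * ∑' n, ‖f n‖ ^ p) := by
        rw [hsum _ hp1, hsum _ h2p, ← ENNReal.ofReal_mul (by positivity),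
          ← ENNReal.ofReal_mul (by positivity), ← ENNReal.ofReal_add (by positivity)
          (by positivity), ← ENNReal.ofReal_mul (by linarith)]
        congr 1
        ring

/-- If `φ ≥ 0` satisfies the weak-type distributional bound
`|{ξ ∈ (0,1)^d : φ(ξ) ≥ s}| ≤ c/s`, then for `1 < p ≤ 2` there is `c_p > 0` with
`(∫_{(0,1)^d} |F(f)(ξ)|^p φ(ξ)^{2-p} dξ)^{1/p} ≤ c_p ‖f‖_{ℓ^p}`. -/
theorem stmt_1 (d : ℕ) (φ : (Fin d → ℝ) → ℝ) (hφmeas : Measurable φ)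
    (hφ0 : ∀ ξ, 0 ≤ φ ξ) (c : ℝ) (hc : 0 < c)
    (hdist : ∀ s : ℝ, 0 < s →
      volume {ξ ∈ unitCube d | s ≤ φ ξ} ≤ ENNReal.ofReal (c / s))
    (p : ℝ) (hp : 1 < p) (hp2 : p ≤ 2) :
    ∃ cp : ℝ, 0 < cp ∧ ∀ f : (Fin d → ℤ) → ℂ,
      Summable (fun n => ‖f n‖) → Summable (fun n => ‖f n‖ ^ p) →
      (∫ ξ in unitCube d, ‖dft d f ξ‖ ^ p * φ ξ ^ (2 - p)) ^ (1 / p)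
        ≤ cp * (∑' n : Fin d → ℤ, ‖f n‖ ^ p) ^ (1 / p) := by
  have hdist' : ∀ s : ℝ, 0 < s →
      volume.restrict (unitCube d) {ξ | s ≤ φ ξ} ≤ ENNReal.ofReal (c / s) := fun s hs => by
    rw [Measure.restrict_apply (measurableSet_le measurable_const hφmeas), Set.inter_comm]
    exact hdist s hs
  obtain ⟨C, hC, hbound⟩ : ∃ C : ℝ, 0 < C ∧ ∀ f : (Fin d → ℤ) → ℂ,
      Summable (fun n => ‖f n‖) → Summable (fun n => ‖f n‖ ^ p) →
      ∫⁻ ξ in unitCube d, ENNReal.ofReal (‖dft d f ξ‖ ^ p * φ ξ ^ (2 - p))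
        ≤ ENNReal.ofReal (C * ∑' n, ‖f n‖ ^ p) := by
    rcases hp2.eq_or_lt with rfl | hlt
    · refine ⟨1, one_pos, fun f hf _ => ?_⟩
      simpa using (lintegral_norm_sq_dft hf).le
    · have h1 : 0 < p - 1 := by linarith
      have h2 : 0 < 2 - p := by linarith
      exact ⟨p * (4 * c / (p - 1) + 4 / (2 - p)), by positivity, fun f hf hfp =>
        lintegral_norm_dft_rpow_mul_le hφmeas hφ0 hc hdist' hp hlt hf hfp⟩
  refine ⟨C ^ (1 / p), by positivity, fun f hf hfp => ?_⟩
  have hX : 0 ≤ ∑' n, ‖f n‖ ^ p := tsum_nonneg fun _ => by positivity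
  have hnn : ∀ ξ, 0 ≤ ‖dft d f ξ‖ ^ p * φ ξ ^ (2 - p) := fun ξ =>
    mul_nonneg (by positivity) (Real.rpow_nonneg (hφ0 ξ) _)
  have hFm : Measurable fun ξ => ‖dft d f ξ‖ := (continuous_dft hf).norm.measurable
  rw [← Real.mul_rpow hC.le hX]
  refine Real.rpow_le_rpow (integral_nonneg hnn) ?_ (by positivity)
  rw [integral_eq_lintegral_of_nonneg_ae (.of_forall hnn)
    (Measurable.aestronglyMeasurable (by fun_prop))]
  exact ENNReal.toReal_le_of_le_ofReal (by positivity) (hbound f hf hfp)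
end

section
/- Let 0 < r < d and let m be a measurable function on the torus 𝕋^d satisfying |m(ξ)| ≤ c |ξ|^{−r} for all nonzero ξ ∈ (0,1)^d (for some c > 0). Then the Fourier multiplier operator T_m is bounded from ℓ^p(ℤ^d) to ℓ^q(ℤ^d) whenever 1 < p ≤ 2 ≤ q < ∞ and 1/p − 1/q = r/d. -/
open MeasureTheory Real Complex

/-- The Fourier multiplier operator `T_m`, given by `T_m f = F⁻¹(m · F(f))`. -/
noncomputable def Tmult (d : ℕ) (m : (Fin d → ℝ) → ℂ) (f : (Fin d → ℤ) → ℂ)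
    (n : Fin d → ℤ) : ℂ :=
  ∫ ξ in unitCube d, m ξ * dft d f ξ *
    Complex.exp (-(2 * Real.pi * Complex.I) * ∑ i, (ξ i : ℂ) * (n i : ℂ))

/-- The `ℓ^p(ℤ^d)` norm, as the `L^p` norm with respect to counting measure. -/
noncomputable def lpNorm (d : ℕ) (f : (Fin d → ℤ) → ℂ) (p : ℝ) : ENNReal :=
  eLpNorm f (ENNReal.ofReal p) (Measure.count : Measure (Fin d → ℤ))

/-- The Euclidean norm on `ℝ^d`. -/
noncomputable def euclNorm (d : ℕ) (ξ : Fin d → ℝ) : ℝ :=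
  Real.sqrt (∑ i, ξ i ^ 2)


open scoped ComplexConjugate

/-- The character `ξ ↦ e^{2πi n·ξ}` of the torus. -/
noncomputable def torusChar (d : ℕ) (n : Fin d → ℤ) (ξ : Fin d → ℝ) : ℂ :=
  Complex.exp (2 * Real.pi * Complex.I * ∑ i, (n i : ℂ) * (ξ i : ℂ))

/-- The trigonometric polynomial with frequencies in `S` and coefficients `f`. -/
noncomputable def trigPoly (d : ℕ) (S : Finset (Fin d → ℤ)) (f : (Fin d → ℤ) → ℂ)
    (ξ : Fin d → ℝ) : ℂ :=
  ∑ n ∈ S, f n * torusChar d n ξ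

lemma torusChar_eq_exp_mul_I (d : ℕ) (n : Fin d → ℤ) (ξ : Fin d → ℝ) :
    torusChar d n ξ = Complex.exp ((2 * Real.pi * ∑ i, (n i : ℝ) * ξ i : ℝ) * Complex.I) := by
  unfold torusChar
  push_cast
  congr 1
  ring

lemma norm_torusChar (d : ℕ) (n : Fin d → ℤ) (ξ : Fin d → ℝ) : ‖torusChar d n ξ‖ = 1 := by
  rw [torusChar_eq_exp_mul_I, Complex.norm_exp_ofReal_mul_I]

lemma conj_torusChar (d : ℕ) (n : Fin d → ℤ) (ξ : Fin d → ℝ) :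
    conj (torusChar d n ξ) =
      Complex.exp (-(2 * Real.pi * Complex.I) * ∑ i, (ξ i : ℂ) * (n i : ℂ)) := by
  rw [torusChar_eq_exp_mul_I, ← Complex.exp_conj]
  congr 1
  simp only [map_mul, Complex.conj_ofReal, Complex.conj_I]
  push_cast
  simp only [mul_comm (Complex.ofReal (ξ _))]
  ring

@[fun_prop]
lemma continuous_torusChar (d : ℕ) (n : Fin d → ℤ) : Continuous (torusChar d n) := by
  unfold torusChar
  fun_prop

@[fun_prop]
lemma continuous_trigPoly (d : ℕ) (S : Finset (Fin d → ℤ)) (f : (Fin d → ℤ) → ℂ) :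
    Continuous (trigPoly d S f) := by
  unfold trigPoly
  fun_prop

lemma norm_trigPoly_le (d : ℕ) (S : Finset (Fin d → ℤ)) (f : (Fin d → ℤ) → ℂ)
    (ξ : Fin d → ℝ) : ‖trigPoly d S f ξ‖ ≤ ∑ n ∈ S, ‖f n‖ := by
  refine (norm_sum_le _ _).trans_eq ?_
  simp [norm_torusChar]

lemma measurableSet_unitCube (d : ℕ) : MeasurableSet (unitCube d) :=
  MeasurableSet.univ_pi fun _ => measurableSet_Ioo

lemma volume_unitCube (d : ℕ) : volume (unitCube d) = 1 := by
  simp [unitCube, Real.volume_pi_Ioo]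

instance isFiniteMeasure_restrict_unitCube (d : ℕ) :
    IsFiniteMeasure (volume.restrict (unitCube d)) :=
  ⟨by simp [volume_unitCube]⟩

lemma integral_Ioo_exp_int (k : ℤ) (hk : k ≠ 0) :
    ∫ x in Set.Ioo (0 : ℝ) 1, Complex.exp (2 * Real.pi * Complex.I * k * (x : ℂ)) = 0 := by
  rw [← integral_Ioc_eq_integral_Ioo, ← intervalIntegral.integral_of_le zero_le_one]
  have hc : (2 * Real.pi * Complex.I * k : ℂ) ≠ 0 := by
    have : (k : ℂ) ≠ 0 := by exact_mod_cast hk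
    have := Complex.two_pi_I_ne_zero
    positivity
  rw [integral_exp_mul_complex hc]
  have : Complex.exp (2 * Real.pi * Complex.I * k * ((1 : ℝ) : ℂ)) = 1 := by
    rw [Complex.exp_eq_one_iff]
    exact ⟨k, by push_cast; ring⟩
  rw [this]
  simp

lemma integral_unitCube_torusChar_mul_conj (d : ℕ) (n k : Fin d → ℤ) :
    ∫ ξ in unitCube d, torusChar d n ξ * conj (torusChar d k ξ) = if n = k then 1 else 0 := by
  split_ifs with h
  · subst h
    simp [Complex.mul_conj, Complex.normSq_eq_norm_sq, norm_torusChar, volume_unitCube,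
      Measure.real]
  · obtain ⟨i, hi⟩ : ∃ i, n i ≠ k i := by
      by_contra! hcon
      exact h (funext hcon)
    have hprod : ∀ ξ : Fin d → ℝ, torusChar d n ξ * conj (torusChar d k ξ) =
        ∏ i, Complex.exp (2 * Real.pi * Complex.I * ((n i - k i : ℤ) : ℂ) * (ξ i : ℂ)) := by
      intro ξ
      rw [conj_torusChar, torusChar, ← Complex.exp_add, ← Complex.exp_sum]
      congr 1
      rw [Finset.mul_sum, Finset.mul_sum, ← Finset.sum_add_distrib]
      refine Finset.sum_congr rfl fun i _ => ?_
      push_cast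
      ring
    simp_rw [hprod]
    rw [unitCube, volume_pi, Measure.restrict_pi_pi,
      integral_fintype_prod_eq_prod (𝕜 := ℂ)
        (f := fun i (x : ℝ) => Complex.exp (2 * Real.pi * Complex.I * ((n i - k i : ℤ) : ℂ) * x))]
    exact Finset.prod_eq_zero (Finset.mem_univ i)
      (integral_Ioo_exp_int _ (sub_ne_zero.2 hi))

/-- Parseval's identity for trigonometric polynomials. -/
lemma lintegral_unitCube_norm_trigPoly_sq (d : ℕ) (S : Finset (Fin d → ℤ))
    (f : (Fin d → ℤ) → ℂ) :
    ∫⁻ ξ in unitCube d, ENNReal.ofReal (‖trigPoly d S f ξ‖ ^ 2) =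
      ENNReal.ofReal (∑ n ∈ S, ‖f n‖ ^ 2) := by
  have hint : ∀ n k : Fin d → ℤ, IntegrableOn
      (fun ξ => f n * conj (f k) * (torusChar d n ξ * conj (torusChar d k ξ))) (unitCube d) := by
    intro n k
    refine Integrable.of_bound (C := ‖f n‖ * ‖f k‖) (by fun_prop) (ae_of_all _ fun ξ => ?_)
    simp [norm_torusChar]
  have hsq : ∀ ξ, ((‖trigPoly d S f ξ‖ ^ 2 : ℝ) : ℂ) =
      ∑ n ∈ S, ∑ k ∈ S, f n * conj (f k) * (torusChar d n ξ * conj (torusChar d k ξ)) := by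
    intro ξ
    rw [← Complex.normSq_eq_norm_sq, ← Complex.mul_conj, trigPoly, map_sum, Finset.sum_mul_sum]
    refine Finset.sum_congr rfl fun n _ => Finset.sum_congr rfl fun k _ => ?_
    rw [map_mul]
    ring
  rw [← ofReal_integral_eq_lintegral_ofReal]
  · congr 1
    apply Complex.ofReal_injective
    rw [← integral_complex_ofReal]
    simp_rw [hsq]
    rw [integral_finsetSum _ fun n _ => integrable_finsetSum _ fun k _ => hint n k]
    simp_rw [integral_finsetSum _ fun k _ => hint _ k, integral_const_mul,
      integral_unitCube_torusChar_mul_conj]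
    push_cast
    refine Finset.sum_congr rfl fun n hn => ?_
    simp [hn, Complex.mul_conj, Complex.normSq_eq_norm_sq]
  · refine Integrable.of_bound (C := (∑ n ∈ S, ‖f n‖) ^ 2) (by fun_prop) (ae_of_all _ fun ξ => ?_)
    rw [Real.norm_of_nonneg (by positivity)]
    gcongr
    exact norm_trigPoly_le d S f ξ
  · exact ae_of_all _ fun ξ => by positivity

lemma sum_range_ite_lt_rpow_le {σ α t : ℝ} (hσ : 0 < σ) (hσ1 : σ < 1) (hα : 0 < α)
    (ht : 0 ≤ t) (N : ℕ) :
    ∑ j ∈ Finset.range N, (if σ ^ j < t then (σ ^ j) ^ α else 0) ≤ (1 - σ ^ α)⁻¹ * t ^ α := by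
  have hs : 0 < 1 - σ ^ α := sub_pos.2 (Real.rpow_lt_one hσ.le hσ1 hα)
  have hstep : ∀ j, (if σ ^ j < t then (σ ^ j) ^ α else 0) ≤
      (1 - σ ^ α)⁻¹ * (min (σ ^ j) t ^ α - min (σ ^ (j + 1)) t ^ α) := by
    intro j
    have hle : σ ^ (j + 1) ≤ σ ^ j := pow_le_pow_of_le_one hσ.le hσ1.le (Nat.le_succ j)
    split_ifs with h
    · rw [min_eq_left h.le, min_eq_left (hle.trans h.le), pow_succ,
        Real.mul_rpow (by positivity) hσ.le]
      field_simp
      exact le_rfl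
    · have : min (σ ^ (j + 1)) t ^ α ≤ min (σ ^ j) t ^ α := by gcongr
      exact mul_nonneg (by positivity) (sub_nonneg.2 this)
  refine (Finset.sum_le_sum fun j _ => hstep j).trans ?_
  rw [← Finset.mul_sum, Finset.sum_range_sub']
  gcongr
  have h1 : min (σ ^ 0) t ^ α ≤ t ^ α := by
    gcongr
    exact min_le_right _ _
  have h2 : 0 ≤ min (σ ^ N) t ^ α := by positivity
  linarith

lemma sum_range_ite_le_rpow_neg_le {σ β t : ℝ} (hσ : 0 < σ) (hσ1 : σ < 1) (hβ : 0 < β)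
    (ht : 0 < t) (N : ℕ) :
    ∑ j ∈ Finset.range N, (if t ≤ σ ^ j then (σ ^ j) ^ (-β) else 0) ≤
      (1 - σ ^ β)⁻¹ * t ^ (-β) := by
  have hs : 0 < 1 - σ ^ β := sub_pos.2 (Real.rpow_lt_one hσ.le hσ1 hβ)
  have hanti : ∀ {x y : ℝ}, 0 < x → x ≤ y → y ^ (-β) ≤ x ^ (-β) := fun hx hxy =>
    Real.rpow_le_rpow_of_nonpos hx hxy (by linarith)
  have hstep : ∀ j, (if t ≤ σ ^ j then (σ ^ j) ^ (-β) else 0) ≤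
      (1 - σ ^ β)⁻¹ * (max (σ⁻¹ * σ ^ (j + 1)) t ^ (-β) - max (σ⁻¹ * σ ^ j) t ^ (-β)) := by
    intro j
    have hshift : σ⁻¹ * σ ^ (j + 1) = σ ^ j := by
      rw [pow_succ]
      field_simp
    have hle : σ ^ j ≤ σ⁻¹ * σ ^ j :=
      le_mul_of_one_le_left (by positivity) ((one_le_inv₀ hσ).2 hσ1.le)
    rw [hshift]
    split_ifs with h
    · rw [max_eq_left h, max_eq_left (h.trans hle), Real.mul_rpow (by positivity) (by positivity),
        Real.inv_rpow hσ.le, Real.rpow_neg hσ.le, inv_inv]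
      field_simp
      exact le_rfl
    · have : max (σ⁻¹ * σ ^ j) t ^ (-β) ≤ max (σ ^ j) t ^ (-β) :=
        hanti (lt_max_of_lt_right ht) (max_le_max hle le_rfl)
      exact mul_nonneg (by positivity) (sub_nonneg.2 this)
  refine (Finset.sum_le_sum fun j _ => hstep j).trans ?_
  rw [← Finset.mul_sum, Finset.sum_range_sub fun j => max (σ⁻¹ * σ ^ j) t ^ (-β)]
  gcongr
  have h1 : max (σ⁻¹ * σ ^ N) t ^ (-β) ≤ t ^ (-β) := hanti ht (le_max_right _ _)
  have h2 : 0 ≤ max (σ⁻¹ * σ ^ 0) t ^ (-β) := by positivity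
  linarith

/-- The numerical estimate behind the real interpolation between `ℓ¹` and `ℓ²`. -/
lemma sum_range_truncations_le {σ p t : ℝ} (hσ : 0 < σ) (hσ1 : σ < 1) (hp : 1 < p)
    (hp2 : p < 2) (ht : 0 ≤ t) (N : ℕ) :
    ∑ j ∈ Finset.range N, ((if σ ^ j < t then (σ ^ j) ^ (p - 1) * t else 0) +
        (if t ≤ σ ^ j then (σ ^ j) ^ (p - 2) * t ^ 2 else 0)) ≤
      ((1 - σ ^ (p - 1))⁻¹ + (1 - σ ^ (2 - p))⁻¹) * t ^ p := by
  rcases ht.eq_or_lt with rfl | ht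
  · have hneg : ∀ j : ℕ, ¬ σ ^ j < 0 := fun j => not_lt.2 (by positivity)
    simp [hneg, Real.zero_rpow (by linarith : p ≠ 0)]
  rw [Finset.sum_add_distrib, add_mul]
  have e1 : t ^ (p - 1) * t = t ^ p := by
    rw [← Real.rpow_add_one ht.ne', sub_add_cancel]
  have e2 : t ^ (p - 2) * t ^ 2 = t ^ p := by
    rw [← Real.rpow_natCast, ← Real.rpow_add ht]
    norm_num
  have h1 := mul_le_mul_of_nonneg_right
    (sum_range_ite_lt_rpow_le hσ hσ1 (sub_pos.2 hp) ht.le N) ht.le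
  have h2 := mul_le_mul_of_nonneg_right
    (sum_range_ite_le_rpow_neg_le hσ hσ1 (sub_pos.2 hp2) ht N) (sq_nonneg t)
  rw [neg_sub, mul_assoc, e2, Finset.sum_mul] at h2
  rw [mul_assoc, e1, Finset.sum_mul] at h1
  simp only [ite_mul, zero_mul] at h1 h2
  exact add_le_add h1 h2

/-- The part of the unit cube at distance between `2^{-(j+1)}` and `2^{-j}` from the origin. -/
def dyadicShell (d j : ℕ) : Set (Fin d → ℝ) :=
  unitCube d ∩ {ξ | (2⁻¹ : ℝ) ^ (j + 1) < ‖ξ‖ ∧ ‖ξ‖ ≤ (2⁻¹ : ℝ) ^ j}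

lemma measurableSet_dyadicShell (d j : ℕ) : MeasurableSet (dyadicShell d j) :=
  (measurableSet_unitCube d).inter
    ((measurableSet_lt measurable_const measurable_norm).inter
      (measurableSet_le measurable_norm measurable_const))

lemma norm_pos_of_mem_unitCube {d : ℕ} (hd : 0 < d) {ξ : Fin d → ℝ} (hξ : ξ ∈ unitCube d) :
    0 < ‖ξ‖ := by
  have h := (hξ ⟨0, hd⟩ (Set.mem_univ _)).1
  exact h.trans_le ((le_abs_self _).trans (norm_le_pi_norm ξ ⟨0, hd⟩))

lemma norm_lt_one_of_mem_unitCube {d : ℕ} {ξ : Fin d → ℝ} (hξ : ξ ∈ unitCube d) : ‖ξ‖ < 1 := by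
  rw [pi_norm_lt_iff one_pos]
  intro i
  have h := hξ i (Set.mem_univ _)
  rw [Real.norm_of_nonneg h.1.le]
  exact h.2

lemma unitCube_subset_iUnion_dyadicShell {d : ℕ} (hd : 0 < d) :
    unitCube d ⊆ ⋃ j, dyadicShell d j := by
  intro ξ hξ
  obtain ⟨j, hj1, hj2⟩ := exists_nat_pow_near_of_lt_one (norm_pos_of_mem_unitCube hd hξ)
    (norm_lt_one_of_mem_unitCube hξ).le (by norm_num : (0 : ℝ) < 2⁻¹) (by norm_num)
  exact Set.mem_iUnion.2 ⟨j, hξ, hj1, hj2⟩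

lemma volume_dyadicShell_le (d j : ℕ) :
    volume (dyadicShell d j) ≤ ENNReal.ofReal (((2⁻¹ : ℝ) ^ j) ^ d) := by
  have hsub : dyadicShell d j ⊆ Set.univ.pi fun _ => Set.Ioc (0 : ℝ) (2⁻¹ ^ j) := by
    rintro ξ ⟨hξ, -, h⟩ i hi
    exact ⟨(hξ i hi).1, ((le_abs_self _).trans (norm_le_pi_norm ξ i)).trans h⟩
  refine (measure_mono hsub).trans_eq ?_
  rw [Real.volume_pi_Ioc, ENNReal.ofReal_pow (by positivity)]
  simp only [sub_zero, Finset.prod_const, Finset.card_univ, Fintype.card_fin]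

/-- On a dyadic shell, the large coefficients of a trigonometric polynomial are controlled by
their `ℓ¹` norm and the small ones by their `ℓ²` norm. -/
lemma lintegral_dyadicShell_norm_trigPoly_sq_le (d j : ℕ) (S : Finset (Fin d → ℤ))
    (f : (Fin d → ℤ) → ℂ) (μ : ℝ) :
    ∫⁻ ξ in dyadicShell d j, ENNReal.ofReal (‖trigPoly d S f ξ‖ ^ 2) ≤
      ENNReal.ofReal (2 * (((2⁻¹ : ℝ) ^ j) ^ d * (∑ n ∈ S with μ < ‖f n‖, ‖f n‖) ^ 2 +
        ∑ n ∈ S with ‖f n‖ ≤ μ, ‖f n‖ ^ 2)) := by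
  set L := ∑ n ∈ S with μ < ‖f n‖, ‖f n‖
  set T := S.filter fun n => ‖f n‖ ≤ μ with hT
  have hpt : ∀ ξ, ENNReal.ofReal (‖trigPoly d S f ξ‖ ^ 2) ≤
      ENNReal.ofReal (2 * L ^ 2) + 2 * ENNReal.ofReal (‖trigPoly d T f ξ‖ ^ 2) := by
    intro ξ
    have hsplit : trigPoly d S f ξ =
        trigPoly d (S.filter fun n => μ < ‖f n‖) f ξ + trigPoly d T f ξ := by
      rw [hT]
      simp_rw [trigPoly, ← not_lt]
      exact (Finset.sum_filter_add_sum_filter_not S _ _).symm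
    have h1 := norm_trigPoly_le d (S.filter fun n => μ < ‖f n‖) f ξ
    have h2 : ‖trigPoly d S f ξ‖ ≤ L + ‖trigPoly d T f ξ‖ := by
      rw [hsplit]
      exact (norm_add_le _ _).trans (by gcongr)
    rw [show (2 : ENNReal) = ENNReal.ofReal 2 by simp, ← ENNReal.ofReal_mul (by norm_num),
      ← ENNReal.ofReal_add (by positivity) (by positivity)]
    apply ENNReal.ofReal_le_ofReal
    have h3 := pow_le_pow_left₀ (norm_nonneg _) h2 2
    nlinarith [sq_nonneg (L - ‖trigPoly d T f ξ‖)]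
  refine (lintegral_mono hpt).trans ?_
  rw [lintegral_add_left measurable_const, setLIntegral_const,
    lintegral_const_mul _ (by fun_prop), mul_add, ENNReal.ofReal_add (by positivity)
      (by positivity)]
  gcongr
  · refine (mul_le_mul_right (volume_dyadicShell_le d j) _).trans_eq ?_
    rw [← ENNReal.ofReal_mul (by positivity)]
    congr 1
    ring
  · rw [ENNReal.ofReal_mul (by norm_num), ENNReal.ofReal_ofNat,
      ← lintegral_unitCube_norm_trigPoly_sq]
    gcongr
    exact Set.inter_subset_left

lemma sq_sum_filter_lt_le {ι : Type*} (S : Finset ι) (t : ι → ℝ) (ht : ∀ i, 0 ≤ t i) {p x : ℝ}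
    (hp : 1 < p) (hx : 0 < x) (hS : ∑ i ∈ S, t i ^ p ≤ 1) :
    (∑ i ∈ S with x < t i, t i) ^ 2 ≤ x ^ (1 - p) * ∑ i ∈ S with x < t i, t i := by
  have hnn : 0 ≤ ∑ i ∈ S with x < t i, t i := Finset.sum_nonneg fun i _ => ht i
  rw [sq]
  gcongr
  calc ∑ i ∈ S with x < t i, t i ≤ ∑ i ∈ S with x < t i, x ^ (1 - p) * t i ^ p := by
        refine Finset.sum_le_sum fun i hi => ?_
        have hxi := (Finset.mem_filter.1 hi).2
        have hti := hx.trans hxi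
        calc t i = t i ^ (1 - p) * t i ^ p := by
              rw [← Real.rpow_add hti, sub_add_cancel, Real.rpow_one]
          _ ≤ x ^ (1 - p) * t i ^ p := by
              gcongr ?_ * _
              exact Real.rpow_le_rpow_of_nonpos hx hxi.le (by linarith)
    _ ≤ ∑ i ∈ S, x ^ (1 - p) * t i ^ p :=
        Finset.sum_le_sum_of_subset_of_nonneg (Finset.filter_subset _ _) fun i _ _ => by
          have := ht i
          positivity
    _ ≤ x ^ (1 - p) := by
        rw [← Finset.mul_sum]
        exact mul_le_of_le_one_right (by positivity) hS

/-- The constant in Pitt's inequality for `p < 2`. -/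
noncomputable def pittConst (d : ℕ) (p : ℝ) : ℝ :=
  2 * 2 ^ (d * (2 / p - 1)) * ((1 - (2 ^ (-(d / p)) : ℝ) ^ (p - 1))⁻¹ +
    (1 - (2 ^ (-(d / p)) : ℝ) ^ (2 - p))⁻¹)

lemma lintegral_pitt_normalized {d : ℕ} (hd : 0 < d) {p : ℝ} (hp : 1 < p) (hp2 : p < 2)
    (S : Finset (Fin d → ℤ)) (f : (Fin d → ℤ) → ℂ) (hf : ∑ n ∈ S, ‖f n‖ ^ p ≤ 1) :
    ∫⁻ ξ in unitCube d, ENNReal.ofReal (‖ξ‖ ^ (-(d * (2 / p - 1))) * ‖trigPoly d S f ξ‖ ^ 2) ≤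
      ENNReal.ofReal (pittConst d p) := by
  have hp0 : 0 < p := by linarith
  have hd' : (0 : ℝ) < d := by exact_mod_cast hd
  set a : ℝ := d * (2 / p - 1) with ha
  set σ : ℝ := 2 ^ (-(d / p)) with hσdef
  have ha0 : 0 ≤ a := by
    have : 1 ≤ 2 / p := by
      rw [one_le_div hp0]
      exact hp2.le
    exact mul_nonneg hd'.le (by linarith)
  have hσ : 0 < σ := by positivity
  have hσ1 : σ < 1 := Real.rpow_lt_one_of_one_lt_of_neg (by norm_num) (by
    have : 0 < d / p := by positivity
    linarith)
  have h2j : ∀ j : ℕ, ((2⁻¹ : ℝ) ^ j) = 2 ^ (-(j : ℝ)) := fun j => by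
    rw [Real.rpow_neg (by norm_num), Real.rpow_natCast, inv_pow]
  have hσj : ∀ (j : ℕ) (s : ℝ), (σ ^ j) ^ s = 2 ^ (-(d / p) * j * s) := fun j s => by
    rw [hσdef, ← Real.rpow_natCast, ← Real.rpow_mul (by positivity),
      ← Real.rpow_mul (by norm_num), mul_assoc]
  have hshell : ∀ j, ∫⁻ ξ in dyadicShell d j,
        ENNReal.ofReal (‖ξ‖ ^ (-a) * ‖trigPoly d S f ξ‖ ^ 2) ≤
      ENNReal.ofReal (2 * 2 ^ a * ∑ n ∈ S,
        ((if σ ^ j < ‖f n‖ then (σ ^ j) ^ (p - 1) * ‖f n‖ else 0) +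
        (if ‖f n‖ ≤ σ ^ j then (σ ^ j) ^ (p - 2) * ‖f n‖ ^ 2 else 0))) := by
    intro j
    calc _ ≤ ∫⁻ ξ in dyadicShell d j, ENNReal.ofReal (2 ^ (a * (j + 1))) *
            ENNReal.ofReal (‖trigPoly d S f ξ‖ ^ 2) := by
          refine setLIntegral_mono' (measurableSet_dyadicShell d j) fun ξ hξ => ?_
          rw [← ENNReal.ofReal_mul (by positivity)]
          gcongr
          calc ‖ξ‖ ^ (-a) ≤ ((2⁻¹ : ℝ) ^ (j + 1)) ^ (-a) :=
                Real.rpow_le_rpow_of_nonpos (by positivity) hξ.2.1.le (by linarith)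
            _ = 2 ^ (a * (j + 1)) := by
                rw [h2j, ← Real.rpow_mul (by norm_num)]
                congr 1
                push_cast
                ring
      _ ≤ ENNReal.ofReal (2 ^ (a * (j + 1))) *
          ENNReal.ofReal (2 * (((2⁻¹ : ℝ) ^ j) ^ d * (∑ n ∈ S with σ ^ j < ‖f n‖, ‖f n‖) ^ 2 +
            ∑ n ∈ S with ‖f n‖ ≤ σ ^ j, ‖f n‖ ^ 2)) := by
          rw [lintegral_const_mul _ (by fun_prop)]
          gcongr
          exact lintegral_dyadicShell_norm_trigPoly_sq_le d j S f (σ ^ j)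
      _ ≤ _ := by
          rw [← ENNReal.ofReal_mul (by positivity)]
          apply ENNReal.ofReal_le_ofReal
          have h1 := sq_sum_filter_lt_le S (fun n => ‖f n‖) (fun _ => norm_nonneg _) hp
            (pow_pos hσ j) hf
          rw [Finset.sum_add_distrib, ← Finset.sum_filter, ← Finset.sum_filter, ← Finset.mul_sum,
            ← Finset.mul_sum]
          have e1 : (2 : ℝ) ^ (a * (j + 1)) * (((2⁻¹ : ℝ) ^ j) ^ d * (σ ^ j) ^ (1 - p)) =
              2 ^ a * (σ ^ j) ^ (p - 1) := by
            rw [h2j, ← Real.rpow_natCast _ d, ← Real.rpow_mul (by norm_num), hσj, hσj,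
              ← Real.rpow_add (by norm_num), ← Real.rpow_add (by norm_num),
              ← Real.rpow_add (by norm_num)]
            congr 1
            rw [ha]
            field_simp
            ring
          have e2 : (2 : ℝ) ^ (a * (j + 1)) = 2 ^ a * (σ ^ j) ^ (p - 2) := by
            rw [hσj, ← Real.rpow_add (by norm_num)]
            congr 1
            rw [ha]
            field_simp
            ring
          calc _ ≤ (2 : ℝ) ^ (a * (j + 1)) * (2 * (((2⁻¹ : ℝ) ^ j) ^ d *
                ((σ ^ j) ^ (1 - p) * ∑ n ∈ S with σ ^ j < ‖f n‖, ‖f n‖) +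
                  ∑ n ∈ S with ‖f n‖ ≤ σ ^ j, ‖f n‖ ^ 2)) := by gcongr
            _ = 2 * ((2 : ℝ) ^ (a * (j + 1)) * (((2⁻¹ : ℝ) ^ j) ^ d * (σ ^ j) ^ (1 - p))) *
                  (∑ n ∈ S with σ ^ j < ‖f n‖, ‖f n‖) +
                2 * (2 : ℝ) ^ (a * (j + 1)) * ∑ n ∈ S with ‖f n‖ ≤ σ ^ j, ‖f n‖ ^ 2 := by ring
            _ = _ := by
              rw [e1, e2]
              ring
  refine (lintegral_mono_set (unitCube_subset_iUnion_dyadicShell hd)).trans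
    ((lintegral_iUnion_le _ _).trans ((ENNReal.tsum_le_tsum hshell).trans ?_))
  refine ENNReal.tsum_le_of_sum_range_le fun N => ?_
  rw [← ENNReal.ofReal_sum_of_nonneg fun j _ => by positivity]
  apply ENNReal.ofReal_le_ofReal
  rw [← Finset.mul_sum, Finset.sum_comm, pittConst]
  gcongr
  have hc1 : 0 < 1 - σ ^ (p - 1) := sub_pos.2 (Real.rpow_lt_one hσ.le hσ1 (by linarith))
  have hc2 : 0 < 1 - σ ^ (2 - p) := sub_pos.2 (Real.rpow_lt_one hσ.le hσ1 (by linarith))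
  refine (Finset.sum_le_sum fun n _ =>
    sum_range_truncations_le hσ hσ1 hp hp2 (norm_nonneg (f n)) N).trans ?_
  rw [← Finset.mul_sum]
  exact mul_le_of_le_one_right (by positivity) hf

/-- A discrete form of Pitt's inequality: the Fourier transform maps `ℓ^p` to `L²` with the
weight `|ξ|^{-d(2/p - 1)}` for `1 < p ≤ 2`. -/
lemma exists_lintegral_pitt {d : ℕ} (hd : 0 < d) {p : ℝ} (hp : 1 < p) (hp2 : p ≤ 2) :
    ∃ C : ℝ, 0 ≤ C ∧ ∀ (S : Finset (Fin d → ℤ)) (f : (Fin d → ℤ) → ℂ),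
      ∫⁻ ξ in unitCube d,
          ENNReal.ofReal (‖ξ‖ ^ (-(d * (2 / p - 1))) * ‖trigPoly d S f ξ‖ ^ 2) ≤
        ENNReal.ofReal (C * ((∑ n ∈ S, ‖f n‖ ^ p) ^ (1 / p)) ^ 2) := by
  have hp0 : 0 < p := by linarith
  rcases hp2.eq_or_lt with rfl | hp2
  · refine ⟨1, zero_le_one, fun S f => ?_⟩
    rw [← Real.sqrt_eq_rpow, Real.sq_sqrt (by positivity)]
    simp only [div_self (two_ne_zero (α := ℝ)), sub_self, mul_zero, neg_zero, Real.rpow_zero, one_mul,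
      Real.rpow_two, lintegral_unitCube_norm_trigPoly_sq, le_refl]
  refine ⟨max (pittConst d p) 0, le_max_right _ _, fun S f => ?_⟩
  set A := (∑ n ∈ S, ‖f n‖ ^ p) ^ (1 / p) with hA
  have hsum : 0 ≤ ∑ n ∈ S, ‖f n‖ ^ p := by positivity
  have hAp : A ^ p = ∑ n ∈ S, ‖f n‖ ^ p := by
    rw [hA, ← Real.rpow_mul hsum, one_div_mul_cancel hp0.ne', Real.rpow_one]
  have hA0 : 0 ≤ A := by positivity
  rcases hA0.eq_or_lt with hA0 | hA0
  · have hz : ∀ n ∈ S, f n = 0 := by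
      rw [← hA0, Real.zero_rpow hp0.ne', eq_comm,
        Finset.sum_eq_zero_iff_of_nonneg fun n _ => by positivity] at hAp
      intro n hn
      have := hAp n hn
      rw [Real.rpow_eq_zero (norm_nonneg _) hp0.ne'] at this
      exact norm_eq_zero.1 this
    have : ∀ ξ, trigPoly d S f ξ = 0 := fun ξ =>
      Finset.sum_eq_zero fun n hn => by rw [hz n hn, zero_mul]
    simp [this]
  have hscale : ∀ ξ, trigPoly d S f ξ = A * trigPoly d S (fun n => (A : ℂ)⁻¹ * f n) ξ := by
    intro ξ
    have : (A : ℂ) ≠ 0 := by exact_mod_cast hA0.ne'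
    rw [trigPoly, trigPoly, Finset.mul_sum]
    refine Finset.sum_congr rfl fun n _ => ?_
    field_simp
  have hnorm : ∑ n ∈ S, ‖(A : ℂ)⁻¹ * f n‖ ^ p ≤ 1 := by
    simp_rw [norm_mul, norm_inv, Complex.norm_real, Real.norm_of_nonneg hA0.le]
    simp_rw [Real.mul_rpow (inv_nonneg.2 hA0.le) (norm_nonneg _)]
    rw [← Finset.mul_sum, ← hAp, Real.inv_rpow hA0.le, inv_mul_cancel₀ (by positivity)]
  have hpt : ∀ ξ : Fin d → ℝ,
      ENNReal.ofReal (‖ξ‖ ^ (-(d * (2 / p - 1))) * ‖trigPoly d S f ξ‖ ^ 2) =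
      ENNReal.ofReal (A ^ 2) * ENNReal.ofReal (‖ξ‖ ^ (-(d * (2 / p - 1))) *
        ‖trigPoly d S (fun n => (A : ℂ)⁻¹ * f n) ξ‖ ^ 2) := by
    intro ξ
    rw [← ENNReal.ofReal_mul (by positivity), hscale ξ, norm_mul, Complex.norm_real,
      Real.norm_of_nonneg hA0.le]
    congr 1
    ring
  simp_rw [hpt]
  rw [lintegral_const_mul' _ _ ENNReal.ofReal_ne_top, mul_comm (max _ _),
    ENNReal.ofReal_mul (by positivity)]
  gcongr
  exact (lintegral_pitt_normalized hd hp hp2 S _ hnorm).trans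
    (ENNReal.ofReal_le_ofReal (le_max_left _ _))

lemma norm_le_euclNorm (d : ℕ) (ξ : Fin d → ℝ) : ‖ξ‖ ≤ euclNorm d ξ := by
  rw [euclNorm, pi_norm_le_iff_of_nonneg (Real.sqrt_nonneg _)]
  intro i
  rw [Real.norm_eq_abs, ← Real.sqrt_sq_eq_abs]
  exact Real.sqrt_le_sqrt (Finset.single_le_sum (f := fun i => ξ i ^ 2)
    (fun i _ => sq_nonneg _) (Finset.mem_univ i))

/-- The bilinear form of the multiplier is bounded on `ℓ^p × ℓ^s`. -/
lemma exists_lintegral_mul_trigPoly_le {d : ℕ} (hd : 0 < d) {m : (Fin d → ℝ) → ℂ}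
    {r c : ℝ} (hr : 0 < r) (hc : 0 < c)
    (hbound : ∀ ξ ∈ unitCube d, ξ ≠ 0 → ‖m ξ‖ ≤ c * euclNorm d ξ ^ (-r))
    {p s : ℝ} (hp : 1 < p) (hp2 : p ≤ 2) (hs : 1 < s) (hs2 : s ≤ 2)
    (hps : 1 / p + 1 / s - 1 = r / d) :
    ∃ K : ℝ, 0 ≤ K ∧ ∀ (S G : Finset (Fin d → ℤ)) (f g : (Fin d → ℤ) → ℂ),
      ∫⁻ ξ in unitCube d, ENNReal.ofReal (‖m ξ‖ * (‖trigPoly d S f ξ‖ * ‖trigPoly d G g ξ‖)) ≤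
        ENNReal.ofReal (K * (∑ n ∈ S, ‖f n‖ ^ p) ^ (1 / p) * (∑ n ∈ G, ‖g n‖ ^ s) ^ (1 / s)) := by
  obtain ⟨C₁, hC₁, h₁⟩ := exists_lintegral_pitt hd hp hp2
  obtain ⟨C₂, hC₂, h₂⟩ := exists_lintegral_pitt hd hs hs2
  refine ⟨c * (√C₁ * √C₂), by positivity, fun S G f g => ?_⟩
  have hd' : (0 : ℝ) < d := by exact_mod_cast hd
  have hexp : -(d * (2 / p - 1)) / 2 + -(d * (2 / s - 1)) / 2 = -r := by
    rw [eq_div_iff hd'.ne'] at hps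
    rw [← hps]
    ring
  have hhalf : ∀ (t : ℝ) (C : ℝ) (T : Finset (Fin d → ℤ)) (h : (Fin d → ℤ) → ℂ), 0 ≤ C →
      ∫⁻ ξ in unitCube d, ENNReal.ofReal (‖ξ‖ ^ (-(d * (2 / t - 1))) * ‖trigPoly d T h ξ‖ ^ 2) ≤
        ENNReal.ofReal (C * ((∑ n ∈ T, ‖h n‖ ^ t) ^ (1 / t)) ^ 2) →
      (∫⁻ ξ in unitCube d, ENNReal.ofReal (‖ξ‖ ^ (-(d * (2 / t - 1)) / 2) *
          ‖trigPoly d T h ξ‖) ^ (2 : ℝ)) ^ (1 / (2 : ℝ)) ≤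
        ENNReal.ofReal (√C * (∑ n ∈ T, ‖h n‖ ^ t) ^ (1 / t)) := by
    intro t C T h hC hle
    have hA : 0 ≤ (∑ n ∈ T, ‖h n‖ ^ t) ^ (1 / t) := by positivity
    have hpt : ∀ ξ : Fin d → ℝ, ENNReal.ofReal (‖ξ‖ ^ (-(d * (2 / t - 1)) / 2) *
        ‖trigPoly d T h ξ‖) ^ (2 : ℝ) =
        ENNReal.ofReal (‖ξ‖ ^ (-(d * (2 / t - 1))) * ‖trigPoly d T h ξ‖ ^ 2) := by
      intro ξ
      rw [ENNReal.ofReal_rpow_of_nonneg (by positivity) (by norm_num), Real.rpow_two, mul_pow,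
        ← Real.rpow_two, ← Real.rpow_mul (norm_nonneg _), div_mul_cancel₀ _ two_ne_zero]
    simp_rw [hpt]
    refine (ENNReal.rpow_le_rpow hle (by norm_num)).trans_eq ?_
    rw [ENNReal.ofReal_rpow_of_nonneg (by positivity) (by norm_num), ← Real.sqrt_eq_rpow,
      Real.sqrt_mul hC, Real.sqrt_sq hA]
  calc _ ≤ ∫⁻ ξ in unitCube d, ENNReal.ofReal c *
        (ENNReal.ofReal (‖ξ‖ ^ (-(d * (2 / p - 1)) / 2) * ‖trigPoly d S f ξ‖) *
          ENNReal.ofReal (‖ξ‖ ^ (-(d * (2 / s - 1)) / 2) * ‖trigPoly d G g ξ‖)) := by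
        refine setLIntegral_mono' (measurableSet_unitCube d) fun ξ hξ => ?_
        have hpos := norm_pos_of_mem_unitCube hd hξ
        rw [← ENNReal.ofReal_mul (by positivity), ← ENNReal.ofReal_mul hc.le]
        apply ENNReal.ofReal_le_ofReal
        have hmξ : ‖m ξ‖ ≤ c * ‖ξ‖ ^ (-r) :=
          (hbound ξ hξ (norm_pos_iff.1 hpos)).trans (by
            gcongr c * ?_
            exact Real.rpow_le_rpow_of_nonpos hpos (norm_le_euclNorm d ξ) (by linarith))
        rw [← hexp, Real.rpow_add hpos] at hmξ
        refine (mul_le_mul_of_nonneg_right hmξ (by positivity)).trans_eq ?_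
        ring
    _ ≤ ENNReal.ofReal c *
        (ENNReal.ofReal (√C₁ * (∑ n ∈ S, ‖f n‖ ^ p) ^ (1 / p)) *
          ENNReal.ofReal (√C₂ * (∑ n ∈ G, ‖g n‖ ^ s) ^ (1 / s))) := by
        rw [lintegral_const_mul' _ _ ENNReal.ofReal_ne_top]
        gcongr
        refine (ENNReal.lintegral_mul_le_Lp_mul_Lq _ Real.HolderConjugate.two_two
          (by fun_prop) (by fun_prop)).trans ?_
        gcongr
        · exact hhalf p C₁ S f hC₁ (h₁ S f)
        · exact hhalf s C₂ G g hC₂ (h₂ G g)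
    _ = _ := by
        rw [← ENNReal.ofReal_mul (by positivity), ← ENNReal.ofReal_mul hc.le]
        congr 1
        ring

/-- The multiplier operator applied to the restriction of `f` to the finite set `S`. -/
noncomputable def truncTmult (d : ℕ) (m : (Fin d → ℝ) → ℂ) (S : Finset (Fin d → ℤ))
    (f : (Fin d → ℤ) → ℂ) (n : Fin d → ℤ) : ℂ :=
  ∫ ξ in unitCube d, m ξ * trigPoly d S f ξ * conj (torusChar d n ξ)

lemma sum_truncTmult_mul_conj {d : ℕ} {m : (Fin d → ℝ) → ℂ} (hm : IntegrableOn m (unitCube d))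
    (S G : Finset (Fin d → ℤ)) (f g : (Fin d → ℤ) → ℂ) :
    ∑ n ∈ G, truncTmult d m S f n * conj (g n) =
      ∫ ξ in unitCube d, m ξ * trigPoly d S f ξ * conj (trigPoly d G g ξ) := by
  have hint : ∀ n, IntegrableOn
      (fun ξ => m ξ * trigPoly d S f ξ * conj (torusChar d n ξ) * conj (g n)) (unitCube d) := by
    intro n
    refine (Integrable.mul_bdd (c := 1) (Integrable.mul_bdd (c := ∑ n ∈ S, ‖f n‖) hm
      (by fun_prop) (ae_of_all _ (norm_trigPoly_le d S f))) (by fun_prop)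
      (ae_of_all _ fun ξ => ?_)).mul_const _
    rw [RCLike.norm_conj, norm_torusChar]
  simp_rw [truncTmult, ← integral_mul_const]
  rw [← integral_finsetSum _ fun n _ => hint n]
  congr 1 with ξ
  rw [show trigPoly d G g ξ = ∑ n ∈ G, g n * torusChar d n ξ from rfl, map_sum, Finset.mul_sum]
  refine Finset.sum_congr rfl fun n _ => ?_
  rw [map_mul]
  ring

lemma tendsto_truncTmult {d : ℕ} {m : (Fin d → ℝ) → ℂ} (hm : IntegrableOn m (unitCube d))
    {f : (Fin d → ℤ) → ℂ} (hf : Summable fun n => ‖f n‖) (n : Fin d → ℤ) :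
    Filter.Tendsto (fun S => truncTmult d m S f n) Filter.atTop (nhds (Tmult d m f n)) := by
  unfold truncTmult Tmult
  simp_rw [← conj_torusChar]
  refine tendsto_integral_filter_of_dominated_convergence (fun ξ => ‖m ξ‖ * ∑' n, ‖f n‖)
    (Filter.Eventually.of_forall fun S => ?_) (Filter.Eventually.of_forall fun S => ?_)
    (hm.norm.mul_const _) ?_
  · have := hm.aestronglyMeasurable
    fun_prop
  · refine ae_of_all _ fun ξ => ?_
    rw [norm_mul, norm_mul, RCLike.norm_conj, norm_torusChar, mul_one]
    gcongr
    exact (norm_trigPoly_le d S f ξ).trans (hf.sum_le_tsum S fun _ _ => norm_nonneg _)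
  · refine ae_of_all _ fun ξ => Filter.Tendsto.mul_const _ (Filter.Tendsto.const_mul _ ?_)
    have : Summable fun n => f n * torusChar d n ξ :=
      Summable.of_norm (by simpa [norm_torusChar] using hf)
    exact this.hasSum

/-- The duality argument turning the bilinear estimate into an `ℓ^q` bound. -/
lemma sum_norm_rpow_le_of_forall_dual {ι : Type*} (G : Finset ι) (T : ι → ℂ) {q s B : ℝ}
    (hqs : q.HolderConjugate s) (hB : 0 ≤ B)
    (h : ∀ g : ι → ℂ, ‖∑ n ∈ G, T n * conj (g n)‖ ≤ B * (∑ n ∈ G, ‖g n‖ ^ s) ^ (1 / s)) :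
    ∑ n ∈ G, ‖T n‖ ^ q ≤ B ^ q := by
  have hq : 0 < q := hqs.pos
  set X := ∑ n ∈ G, ‖T n‖ ^ q with hX
  have hX0 : 0 ≤ X := by positivity
  rcases hX0.eq_or_lt with hX0 | hX0
  · rw [← hX0]
    positivity
  have key := h fun n => T n * ((‖T n‖ ^ (q - 2) : ℝ) : ℂ)
  have e1 : ∑ n ∈ G, T n * conj (T n * ((‖T n‖ ^ (q - 2) : ℝ) : ℂ)) = (X : ℂ) := by
    rw [hX]
    push_cast
    refine Finset.sum_congr rfl fun n _ => ?_
    rw [map_mul, Complex.conj_ofReal, ← mul_assoc, Complex.mul_conj, Complex.normSq_eq_norm_sq]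
    norm_cast
    rcases (norm_nonneg (T n)).eq_or_lt with h0 | h0
    · simp [← h0, Real.zero_rpow hq.ne']
    · rw [← Real.rpow_two, ← Real.rpow_add h0]
      congr 1
      ring
  have e2 : ∑ n ∈ G, ‖T n * ((‖T n‖ ^ (q - 2) : ℝ) : ℂ)‖ ^ s = X := by
    refine Finset.sum_congr rfl fun n _ => ?_
    rw [norm_mul, Complex.norm_real, Real.norm_of_nonneg (by positivity)]
    rcases (norm_nonneg (T n)).eq_or_lt with h0 | h0
    · simp [← h0, Real.zero_rpow hq.ne', Real.zero_rpow hqs.symm.pos.ne']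
    · rw [← Real.rpow_one_add' h0.le, ← Real.rpow_mul h0.le]
      · congr 1
        linear_combination hqs.sub_one_mul_conj
      · have := hqs.lt
        linarith
  rw [e1, e2, Complex.norm_real, Real.norm_of_nonneg hX0.le] at key
  have hXq : X ^ (1 / q) ≤ B := by
    have hsplit : X = X ^ (1 / q) * X ^ (1 / s) := by
      rw [← Real.rpow_add hX0, one_div, one_div, hqs.inv_add_inv_eq_one, Real.rpow_one]
    rw [hsplit] at key
    refine le_of_mul_le_mul_right ?_ (Real.rpow_pos_of_pos hX0 (1 / s))
    rwa [← hsplit] at key ⊢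
  calc X = (X ^ (1 / q)) ^ q := by
        rw [← Real.rpow_mul hX0.le, one_div_mul_cancel hq.ne', Real.rpow_one]
    _ ≤ B ^ q := by gcongr

lemma lpNorm_eq_tsum (d : ℕ) (f : (Fin d → ℤ) → ℂ) {p : ℝ} (hp : 0 < p) :
    _root_.lpNorm d f p = (∑' n, ENNReal.ofReal (‖f n‖ ^ p)) ^ (1 / p) := by
  rw [_root_.lpNorm, eLpNorm_eq_lintegral_rpow_enorm_toReal (by simpa using hp)
    ENNReal.ofReal_ne_top, ENNReal.toReal_ofReal hp.le, lintegral_count]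
  simp_rw [← ofReal_norm, ENNReal.ofReal_rpow_of_nonneg (norm_nonneg _) hp.le]

/-- If `|m(ξ)| ≤ c|ξ|^{−r}` on `(0,1)^d \ {0}` with `0 < r < d`, then `T_m` is bounded
from `ℓ^p(ℤ^d)` to `ℓ^q(ℤ^d)` whenever `1 < p ≤ 2 ≤ q < ∞` and `1/p − 1/q = r/d`. -/
theorem stmt_5 (d : ℕ) (m : (Fin d → ℝ) → ℂ) (hm : Measurable m)
    (r : ℝ) (hr : 0 < r) (hrd : r < d) (c : ℝ) (hc : 0 < c)
    (hbound : ∀ ξ ∈ unitCube d, ξ ≠ 0 → ‖m ξ‖ ≤ c * euclNorm d ξ ^ (-r))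
    (p q : ℝ) (hp : 1 < p) (hp2 : p ≤ 2) (h2q : 2 ≤ q)
    (hpq : 1 / p - 1 / q = r / d) :
    ∃ C : ℝ, 0 < C ∧ ∀ f : (Fin d → ℤ) → ℂ, Summable (fun n => ‖f n‖) →
      lpNorm d (Tmult d m f) q ≤ ENNReal.ofReal C * lpNorm d f p := by
  have hd' : (0 : ℝ) < d := hr.trans hrd
  have hd : 0 < d := by exact_mod_cast hd'
  have hp0 : 0 < p := by linarith
  have hq0 : 0 < q := by linarith
  have hqs : q.HolderConjugate (Real.conjExponent q) := .conjExponent (by linarith)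
  set s := Real.conjExponent q
  have hs2 : s ≤ 2 := by
    by_contra! hcon
    have h1 := hqs.inv_add_inv_eq_one
    have h2 : s⁻¹ < 2⁻¹ := inv_strictAnti₀ two_pos hcon
    have h3 : q⁻¹ ≤ 2⁻¹ := inv_anti₀ two_pos h2q
    linarith
  have hps : 1 / p + 1 / s - 1 = r / d := by
    have h1 := hqs.inv_add_inv_eq_one
    rw [← hpq]
    simp only [one_div] at *
    linarith
  obtain ⟨K, hK, hbil⟩ := exists_lintegral_mul_trigPoly_le hd hr hc hbound hp hp2
    hqs.symm.lt hs2 hps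
  have hmint : IntegrableOn m (unitCube d) := by
    refine ⟨hm.aestronglyMeasurable, ?_⟩
    rw [hasFiniteIntegral_iff_norm]
    refine lt_of_le_of_lt ?_ ((hbil {0} {0} 1 1).trans_lt ENNReal.ofReal_lt_top)
    simp [trigPoly, norm_torusChar]
  have hdual : ∀ (S G : Finset (Fin d → ℤ)) (f : (Fin d → ℤ) → ℂ),
      ∑ n ∈ G, ‖truncTmult d m S f n‖ ^ q ≤ (K * (∑ n ∈ S, ‖f n‖ ^ p) ^ (1 / p)) ^ q := by
    intro S G f
    refine sum_norm_rpow_le_of_forall_dual G _ hqs (by positivity) fun g => ?_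
    rw [sum_truncTmult_mul_conj hmint, ← ENNReal.ofReal_le_ofReal_iff (by positivity), ofReal_norm]
    refine (enorm_integral_le_lintegral_enorm _).trans (le_trans (le_of_eq ?_) (hbil S G f g))
    congr 1 with ξ
    rw [← ofReal_norm, norm_mul, norm_mul, RCLike.norm_conj, mul_assoc]
  refine ⟨K + 1, by positivity, fun f hf => ?_⟩
  rw [lpNorm_eq_tsum d _ hq0, one_div, ENNReal.rpow_inv_le_iff hq0, ENNReal.tsum_eq_iSup_sum]
  refine iSup_le fun G => ?_
  refine le_of_tendsto (tendsto_finsetSum G fun n _ => (ENNReal.continuous_ofReal.tendsto _).comp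
    (((tendsto_truncTmult hmint hf n).norm).rpow_const (Or.inr hq0.le)))
    (Filter.Eventually.of_forall fun S => ?_)
  simp only [Function.comp_apply]
  rw [← ENNReal.ofReal_sum_of_nonneg fun n _ => by positivity]
  refine (ENNReal.ofReal_le_ofReal (hdual S G f)).trans ?_
  rw [← ENNReal.ofReal_rpow_of_nonneg (by positivity) hq0.le, ENNReal.ofReal_mul hK,
    ← ENNReal.ofReal_rpow_of_nonneg (by positivity) (by positivity), lpNorm_eq_tsum d f hp0,
    ENNReal.ofReal_sum_of_nonneg fun n _ => by positivity]
  gcongr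
  · linarith
  · exact ENNReal.sum_le_tsum S
end
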